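/- Let φ₁ ∧ φ₂ be a PSL formula where φ₁ is a conjunction of formulae of the form s ≼ s' that includes * ≼ *, and φ₂ is a PSL formula in negation normal form with no occurrence of ≼; suppose φ₁ ∧ φ₂ mentions N₁ standpoint symbols and N₂ occurrences of the ◇_s modalities. If φ₁ ∧ φ₂ is PSL-satisfiable, then for every natural number N > N₁ + N₂ there is a PSL model M* = (Π*, V*) such that: (1) Π* = 𝕊 × {1,…,N}; (2) M*, (S*, 1) ⊨ φ₁ ∧ φ₂ where S* = R(*); and (3) for each (S, j) ∈ Π*, S = {s a standpoint symbol of φ₁ ∧ φ₂ | (S,j) ∈ V*(s)}. -/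

import Mathlib

/-! ### Propositional standpoint logic PSL -/

inductive PSForm : Type where
  | var : ℕ → PSForm
  | le : ℕ → ℕ → PSForm
  | neg : PSForm → PSForm
  | conj : PSForm → PSForm → PSForm
  | disj : PSForm → PSForm → PSForm
  | dia : ℕ → PSForm → PSForm
  | box : ℕ → PSForm → PSForm

/-- A PSL model with a finite nonempty set `W` of precisifications;
`Vs` is the valuation on standpoint symbols (`0` is the universal standpoint
`*`) and `Vp` the valuation on propositional variables. -/
structure PSLM (W : Type) where
  Vs : ℕ → Set W
  Vp : ℕ → Set W
  hfin : Finite W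
  hne : Nonempty W
  hs : ∀ s, (Vs s).Nonempty
  hstar : Vs 0 = Set.univ

def PSLSat {W : Type} (M : PSLM W) : PSForm → W → Prop
  | .var p, π => π ∈ M.Vp p
  | .le s s', _ => M.Vs s ⊆ M.Vs s'
  | .neg a, π => ¬ PSLSat M a π
  | .conj a b, π => PSLSat M a π ∧ PSLSat M b π
  | .disj a b, π => PSLSat M a π ∨ PSLSat M b π
  | .dia s a, _ => ∃ π' ∈ M.Vs s, PSLSat M a π'
  | .box s a, _ => ∀ π' ∈ M.Vs s, PSLSat M a π'

def PSLSatisfiable (φ : PSForm) : Prop :=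
  ∃ (W : Type) (M : PSLM W) (π : W), PSLSat M φ π

/-- Standpoint symbols mentioned in a formula. -/
def standsP : PSForm → Finset ℕ
  | .var _ => ∅
  | .le s s' => {s, s'}
  | .neg a => standsP a
  | .conj a b => standsP a ∪ standsP b
  | .disj a b => standsP a ∪ standsP b
  | .dia s a => insert s (standsP a)
  | .box s a => insert s (standsP a)

/-- Number of occurrences of the `◇_s` modalities. -/
def diaCount : PSForm → ℕ
  | .var _ => 0
  | .le _ _ => 0
  | .neg a => diaCount a
  | .conj a b => diaCount a + diaCount b
  | .disj a b => diaCount a + diaCount b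
  | .dia _ a => diaCount a + 1
  | .box _ a => diaCount a

/-- Pairs `(s, s')` such that `s ≼ s'` occurs in the formula. -/
def lePairsP : PSForm → Finset (ℕ × ℕ)
  | .var _ => ∅
  | .le s s' => {(s, s')}
  | .neg a => lePairsP a
  | .conj a b => lePairsP a ∪ lePairsP b
  | .disj a b => lePairsP a ∪ lePairsP b
  | .dia _ a => lePairsP a
  | .box _ a => lePairsP a

/-- The formula is a conjunction of formulae of the form `s ≼ s'`. -/
def isLeConj : PSForm → Prop
  | .le _ _ => True
  | .conj a b => isLeConj a ∧ isLeConj b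
  | _ => False

/-- Negation normal form with no occurrence of `≼`: negation is applied only
to propositional variables. -/
def IsNNF : PSForm → Prop
  | .var _ => True
  | .neg (.var _) => True
  | .neg _ => False
  | .le _ _ => False
  | .conj a b => IsNNF a ∧ IsNNF b
  | .disj a b => IsNNF a ∧ IsNNF b
  | .dia _ a => IsNNF a
  | .box _ a => IsNNF a

/-- The base relation whose reflexive-transitive closure is `R`:
`{(s,s') | s ≼ s' occurs in φ₁} ∪ {(s,*) | s a standpoint symbol of φ₁ ∧ φ₂}`. -/
def baseRel (φ₁ φ₂ : PSForm) (a b : ℕ) : Prop :=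
  (a, b) ∈ lePairsP φ₁ ∨ (a ∈ standsP (φ₁.conj φ₂) ∧ b = 0)

/-- `R(s) = {s' | (s, s') ∈ R}`. -/
def Rset (φ₁ φ₂ : PSForm) (s : ℕ) : Set ℕ :=
  {s' | Relation.ReflTransGen (baseRel φ₁ φ₂) s s'}

/-- `𝕊 = {R(s) | s a standpoint symbol of φ₁ ∧ φ₂}`. -/
def SSfam (φ₁ φ₂ : PSForm) : Set (Set ℕ) :=
  Rset φ₁ φ₂ '' ↑(standsP (φ₁.conj φ₂))

def diaList : PSForm → List (ℕ × PSForm)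
  | .var _ => []
  | .le _ _ => []
  | .neg a => diaList a
  | .conj a b => diaList a ++ diaList b
  | .disj a b => diaList a ++ diaList b
  | .dia s a => (s, a) :: diaList a
  | .box _ a => diaList a

theorem diaList_length (φ : PSForm) : (diaList φ).length = diaCount φ := by
  induction φ <;> simp_all [diaList, diaCount]

theorem diaList_stands (φ : PSForm) : ∀ x ∈ diaList φ, x.1 ∈ standsP φ := by
  induction φ with
  | var p => simp [diaList]
  | le s t => simp [diaList]
  | neg a ih => exact ih
  | conj a b iha ihb =>
    intro x hx
    simp only [diaList, List.mem_append] at hx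
    simp only [standsP, Finset.mem_union]
    exact hx.imp (iha x) (ihb x)
  | disj a b iha ihb =>
    intro x hx
    simp only [diaList, List.mem_append] at hx
    simp only [standsP, Finset.mem_union]
    exact hx.imp (iha x) (ihb x)
  | dia s a ih =>
    intro x hx
    simp only [diaList, List.mem_cons] at hx
    simp only [standsP, Finset.mem_insert]
    rcases hx with rfl | hx
    · exact Or.inl rfl
    · exact Or.inr (ih x hx)
  | box s a ih =>
    intro x hx
    simp only [standsP, Finset.mem_insert]
    exact Or.inr (ih x hx)

theorem lePairs_stands (φ : PSForm) :
    ∀ x ∈ lePairsP φ, x.1 ∈ standsP φ ∧ x.2 ∈ standsP φ := by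
  induction φ with
  | var p => simp [lePairsP]
  | le s t => simp [lePairsP, standsP]
  | neg a ih => exact ih
  | conj a b iha ihb =>
    intro x hx
    simp only [lePairsP, standsP, Finset.mem_union] at *
    grind
  | disj a b iha ihb =>
    intro x hx
    simp only [lePairsP, standsP, Finset.mem_union] at *
    grind
  | dia s a ih =>
    intro x hx
    simp only [lePairsP, standsP, Finset.mem_insert] at *
    grind
  | box s a ih =>
    intro x hx
    simp only [lePairsP, standsP, Finset.mem_insert] at *
    grind

theorem leConj_sat {W : Type} (M : PSLM W) (φ : PSForm) (h : isLeConj φ) (π : W) :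
    PSLSat M φ π ↔ ∀ x ∈ lePairsP φ, M.Vs x.1 ⊆ M.Vs x.2 := by
  induction φ with
  | le s t => simp [lePairsP, PSLSat]
  | conj a b iha ihb =>
    simp only [isLeConj] at h
    simp only [PSLSat, lePairsP, Finset.mem_union, iha h.1, ihb h.2]
    grind
  | _ => exact h.elim

theorem transfer {W W' : Type} (M : PSLM W) (M' : PSLM W') (f : W' → W)
    (hp : ∀ p w, w ∈ M'.Vp p ↔ f w ∈ M.Vp p) (φ : PSForm) (hn : IsNNF φ)
    (hbox : ∀ s ∈ standsP φ, ∀ w ∈ M'.Vs s, f w ∈ M.Vs s)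
    (hdia : ∀ x ∈ diaList φ, (∃ π ∈ M.Vs x.1, PSLSat M x.2 π) →
      ∃ w ∈ M'.Vs x.1, PSLSat M x.2 (f w)) :
    ∀ w, PSLSat M φ (f w) → PSLSat M' φ w := by
  induction φ with
  | var p => intro w h; exact (hp p w).2 h
  | le s t => exact hn.elim
  | neg a ih =>
    cases a with
    | var p => intro w h h'; exact h ((hp p w).1 h')
    | _ => exact hn.elim
  | conj a b iha ihb =>
    simp only [standsP, diaList, Finset.mem_union, List.mem_append] at hbox hdia
    intro w h
    exact ⟨iha hn.1 (fun s hs => hbox s (Or.inl hs)) (fun x hx => hdia x (Or.inl hx)) w h.1,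
      ihb hn.2 (fun s hs => hbox s (Or.inr hs)) (fun x hx => hdia x (Or.inr hx)) w h.2⟩
  | disj a b iha ihb =>
    simp only [standsP, diaList, Finset.mem_union, List.mem_append] at hbox hdia
    intro w h
    exact Or.imp
      (iha hn.1 (fun s hs => hbox s (Or.inl hs)) (fun x hx => hdia x (Or.inl hx)) w)
      (ihb hn.2 (fun s hs => hbox s (Or.inr hs)) (fun x hx => hdia x (Or.inr hx)) w) h
  | dia s a ih =>
    simp only [standsP, diaList, Finset.mem_insert, List.mem_cons] at hbox hdia
    intro w h
    obtain ⟨v, hv, hv'⟩ := hdia (s, a) (Or.inl rfl) h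
    exact ⟨v, hv, ih hn (fun s hs => hbox s (Or.inr hs)) (fun x hx => hdia x (Or.inr hx)) v hv'⟩
  | box s a ih =>
    simp only [standsP, diaList, Finset.mem_insert] at hbox hdia
    intro w h v hv
    exact ih hn (fun s hs => hbox s (Or.inr hs)) hdia v (h _ (hbox s (Or.inl rfl) v hv))

/-- Normalised small model property for PSL: if `φ₁ ∧ φ₂` is
PSL-satisfiable (with `φ₁` a conjunction of `≼`-formulae including `* ≼ *`,
and `φ₂` in negation normal form without `≼`), then for every
`N > N₁ + N₂` there is a PSL model whose set of precisifications is
`𝕊 × {1,…,N}`, which satisfies `φ₁ ∧ φ₂` at `(S*, 1)` with `S* = R(*)`, and in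
which each precisification `(S, j)` is labelled by exactly the standpoint
symbols in `S`. -/
theorem stmt2 (φ₁ φ₂ : PSForm) (h₁ : isLeConj φ₁)
    (hstar : ((0 : ℕ), (0 : ℕ)) ∈ lePairsP φ₁) (h₂ : IsNNF φ₂)
    (hsat : PSLSatisfiable (φ₁.conj φ₂)) (N : ℕ)
    (hN : (standsP (φ₁.conj φ₂)).card + diaCount (φ₁.conj φ₂) < N) :
    ∃ (M : PSLM (↥(SSfam φ₁ φ₂) × {j : ℕ // j ∈ Finset.Icc 1 N}))
      (hmem : Rset φ₁ φ₂ 0 ∈ SSfam φ₁ φ₂) (hj : 1 ∈ Finset.Icc 1 N),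
      PSLSat M (φ₁.conj φ₂) ⟨⟨Rset φ₁ φ₂ 0, hmem⟩, ⟨1, hj⟩⟩ ∧
      ∀ w : ↥(SSfam φ₁ φ₂) × {j : ℕ // j ∈ Finset.Icc 1 N},
        (w.1 : Set ℕ) = {s : ℕ | s ∈ standsP (φ₁.conj φ₂) ∧ w ∈ M.Vs s} := by
  classical
  obtain ⟨W, M, π₀, hs1, hs2⟩ := hsat
  have hle := (leConj_sat M φ₁ h₁ π₀).1 hs1
  have h0 : 0 ∈ standsP (φ₁.conj φ₂) :=
    Finset.mem_union_left _ (lePairs_stands φ₁ _ hstar).1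
  have hmem : Rset φ₁ φ₂ 0 ∈ SSfam φ₁ φ₂ := ⟨0, h0, rfl⟩
  have hj : 1 ∈ Finset.Icc 1 N := by simp only [Finset.mem_Icc]; omega
  have hclos : ∀ s ∈ standsP (φ₁.conj φ₂), ∀ t ∈ Rset φ₁ φ₂ s,
      t ∈ standsP (φ₁.conj φ₂) := by
    intro s hs t ht
    induction ht with
    | refl => exact hs
    | tail _ hb _ =>
      rcases hb with hb | ⟨_, rfl⟩
      · exact Finset.mem_union_left _ (lePairs_stands φ₁ _ hb).2
      · exact h0
  have hV : ∀ s, ∀ t ∈ Rset φ₁ φ₂ s, M.Vs s ⊆ M.Vs t := by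
    intro s t ht
    induction ht with
    | refl => exact subset_rfl
    | tail _ hb ih =>
      rcases hb with hb | ⟨_, rfl⟩
      · exact ih.trans (hle _ hb)
      · rw [M.hstar]; exact Set.subset_univ _
  have hzero : ∀ S ∈ SSfam φ₁ φ₂, 0 ∈ S := by
    rintro _ ⟨s, hs, rfl⟩
    exact Relation.ReflTransGen.single (Or.inr ⟨hs, rfl⟩)
  have hwit : ∀ x : ℕ × PSForm, ∃ π, (∃ π ∈ M.Vs x.1, PSLSat M x.2 π) →
      π ∈ M.Vs x.1 ∧ PSLSat M x.2 π := by
    intro x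
    by_cases h : ∃ π ∈ M.Vs x.1, PSLSat M x.2 π
    · obtain ⟨π, h1⟩ := h
      exact ⟨π, fun _ => h1⟩
    · exact ⟨π₀, fun h' => (h h').elim⟩
  choose wit hwit using hwit
  let g : ℕ → W := fun j => ((π₀ :: (diaList φ₂).map wit)[j - 1]?).getD π₀
  have hdef : ∀ S : ↥(SSfam φ₁ φ₂), ∃ π : W, ∀ s ∈ S.1, π ∈ M.Vs s := by
    rintro ⟨_, s, hs, rfl⟩
    obtain ⟨π, hπ⟩ := M.hs s
    exact ⟨π, fun t ht => hV s t ht hπ⟩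
  choose d hd using hdef
  let f : ↥(SSfam φ₁ φ₂) × {j : ℕ // j ∈ Finset.Icc 1 N} → W := fun w =>
    if ∀ s ∈ w.1.1, g w.2.1 ∈ M.Vs s then g w.2.1 else d w.1
  have hf : ∀ w, ∀ s ∈ w.1.1, f w ∈ M.Vs s := by
    intro w s hs
    by_cases h : ∀ s ∈ w.1.1, g w.2.1 ∈ M.Vs s
    · simp only [f, if_pos h]; exact h s hs
    · simp only [f, if_neg h]; exact hd _ s hs
  let w0 : ↥(SSfam φ₁ φ₂) × {j : ℕ // j ∈ Finset.Icc 1 N} :=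
    ⟨⟨Rset φ₁ φ₂ 0, hmem⟩, ⟨1, hj⟩⟩
  have hfin : Finite (↥(SSfam φ₁ φ₂)) :=
    ((standsP (φ₁.conj φ₂)).finite_toSet.image _).to_subtype
  let M' : PSLM (↥(SSfam φ₁ φ₂) × {j : ℕ // j ∈ Finset.Icc 1 N}) :=
    { Vs := fun s => {w | s ∈ standsP (φ₁.conj φ₂) → s ∈ w.1.1}
      Vp := fun p => {w | f w ∈ M.Vp p}
      hfin := inferInstance
      hne := ⟨w0⟩
      hs := by
        intro s
        by_cases h : s ∈ standsP (φ₁.conj φ₂)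
        · exact ⟨⟨⟨Rset φ₁ φ₂ s, s, h, rfl⟩, ⟨1, hj⟩⟩, fun _ => Relation.ReflTransGen.refl⟩
        · exact ⟨w0, fun h' => (h h').elim⟩
      hstar := by
        ext w
        simp only [Set.mem_setOf_eq, Set.mem_univ, iff_true]
        exact fun _ => hzero _ w.1.2 }
  refine ⟨M', hmem, hj, ⟨?_, ?_⟩, ?_⟩
  · rw [leConj_sat M' φ₁ h₁]
    rintro ⟨s, t⟩ hx ⟨⟨_, r, hr, rfl⟩, j⟩ hw ht
    have := hw (Finset.mem_union_left _ (lePairs_stands φ₁ _ hx).1)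
    exact Relation.ReflTransGen.tail this (Or.inl hx)
  · refine transfer M M' f (fun _ _ => Iff.rfl) φ₂ h₂ ?_ ?_ w0 ?_
    · intro s hs w hw
      exact hf w s (hw (Finset.mem_union_right _ hs))
    · intro x hx hex
      obtain ⟨k, hk, rfl⟩ := List.mem_iff_getElem.1 hx
      have hxs : (diaList φ₂)[k].1 ∈ standsP (φ₁.conj φ₂) :=
        Finset.mem_union_right _ (diaList_stands φ₂ _ hx)
      have hkN : k + 2 ∈ Finset.Icc 1 N := by
        rw [diaList_length] at hk
        simp only [diaCount] at hN
        simp only [Finset.mem_Icc]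
        omega
      have hg : g (k + 2) = wit (diaList φ₂)[k] := by
        simp [g, hk]
      obtain ⟨hw1, hw2⟩ := hwit _ hex
      refine ⟨⟨⟨Rset φ₁ φ₂ (diaList φ₂)[k].1, _, hxs, rfl⟩, ⟨k + 2, hkN⟩⟩,
        fun _ => Relation.ReflTransGen.refl, ?_⟩
      have hc : ∀ s ∈ Rset φ₁ φ₂ (diaList φ₂)[k].1, g (k + 2) ∈ M.Vs s := by
        intro s hs
        rw [hg]
        exact hV _ s hs hw1
      simp only [f, if_pos hc]
      rw [hg]
      exact hw2
    · have hg : g 1 = π₀ := by simp [g]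
      have hc : ∀ s ∈ Rset φ₁ φ₂ 0, g 1 ∈ M.Vs s := by
        intro s hs
        apply hV 0 s hs
        rw [M.hstar]
        trivial
      have : f w0 = π₀ := by
        simp only [f, w0, if_pos hc]
        exact hg
      rw [this]
      exact hs2
  · rintro ⟨⟨_, r, hr, rfl⟩, j⟩
    ext s
    constructor
    · intro h
      exact ⟨hclos r hr s h, fun _ => h⟩
    · rintro ⟨h, h'⟩
      exact h' h
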